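/- Let n be a positive integer, let N and M be nonnegative integers with M ≤ N, and suppose A(1,n;N,M) ∈ ℤ[q]. Then for any nonnegative integer m, the complex number ∑_{j=1}^{n} w^{−jM}(1 + w^j)^{N+mn}, where w = e^{2πi/n} is a primitive n-th root of unity, equals n² times an integer. -/

import Mathlib

open Polynomial Finset

/-- `A(b,a;n,m) ∈ ℤ[q]`: the polynomial `(1-q^a)·∏_{i=1}^m (1-q^i)·∏_{i=1}^{n-m} (1-q^i)`
divides `(1-q^b)·∏_{i=1}^n (1-q^i)` in `ℤ[q]`. -/
def AIsPoly (b a n m : ℕ) : Prop :=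
  ((1 - X ^ a) * (∏ i ∈ range m, (1 - X ^ (i + 1))) *
      ∏ i ∈ range (n - m), (1 - X ^ (i + 1)) : Polynomial ℤ) ∣
    (1 - X ^ b) * ∏ i ∈ range n, (1 - X ^ (i + 1))

lemma one_sub_X_pow_ne_zero {k : ℕ} (hk : 0 < k) : (1 - X ^ k : ℂ[X]) ≠ 0 := by
  rw [← neg_sub, neg_ne_zero]
  exact (monic_X_pow_sub_C (1 : ℂ) hk.ne').ne_zero

lemma prod_one_sub_X_pow_ne_zero (N : ℕ) :
    (∏ i ∈ range N, (1 - X ^ (i + 1)) : ℂ[X]) ≠ 0 :=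
  prod_ne_zero_iff.2 fun _ _ => one_sub_X_pow_ne_zero (Nat.succ_pos _)

lemma rootMultiplicity_one_sub_X_pow {d : ℕ} {ζ : ℂ} (hζ : IsPrimitiveRoot ζ d) {k : ℕ}
    (hk : 0 < k) : rootMultiplicity ζ (1 - X ^ k : ℂ[X]) = if d ∣ k then 1 else 0 := by
  have hroot : IsRoot (1 - X ^ k : ℂ[X]) ζ ↔ d ∣ k := by
    rw [← hζ.pow_eq_one_iff_dvd, IsRoot.def]
    simp [sub_eq_zero, eq_comm (a := (1 : ℂ))]
  split_ifs with h
  · have hsep : (1 - X ^ k : ℂ[X]).Separable := by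
      have h := separable_X_pow_sub_C (n := k) (1 : ℂ) (by exact_mod_cast hk.ne') one_ne_zero
      exact h.of_dvd ⟨-1, by simp⟩
    exact le_antisymm (rootMultiplicity_le_one_of_separable hsep ζ)
      ((rootMultiplicity_pos (one_sub_X_pow_ne_zero hk)).2 (hroot.2 h))
  · exact rootMultiplicity_eq_zero fun h' => h (hroot.1 h')

lemma rootMultiplicity_prod_one_sub_X_pow {d : ℕ} {ζ : ℂ} (hζ : IsPrimitiveRoot ζ d) (N : ℕ) :
    rootMultiplicity ζ (∏ i ∈ range N, (1 - X ^ (i + 1)) : ℂ[X]) = N / d := by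
  induction N with
  | zero => simp
  | succ N ih =>
    have h := prod_one_sub_X_pow_ne_zero (N + 1)
    rw [prod_range_succ] at h ⊢
    rw [rootMultiplicity_mul h, ih, rootMultiplicity_one_sub_X_pow hζ (Nat.succ_pos N),
      Nat.succ_div]

/-- If `A(1,n;N,M)` is a polynomial then `N mod d < M mod d` for each divisor `d > 1` of `n`. -/
lemma AIsPoly.mod_lt_mod {n N M d : ℕ} (hn : 0 < n) (hMN : M ≤ N) (hA : AIsPoly 1 n N M)
    (hd : 1 < d) (hdn : d ∣ n) : N % d < M % d := by
  have hζ := Complex.isPrimitiveRoot_exp d (by omega)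
  set ζ := Complex.exp (2 * Real.pi * Complex.I / d)
  have hdvd := Polynomial.map_dvd (Int.castRingHom ℂ) hA
  simp only [Polynomial.map_mul, Polynomial.map_sub, Polynomial.map_one, Polynomial.map_pow,
    Polynomial.map_X, Polynomial.map_prod] at hdvd
  have hl : ((1 - X ^ n) * ∏ i ∈ range M, (1 - X ^ (i + 1)) : ℂ[X]) ≠ 0 :=
    mul_ne_zero (one_sub_X_pow_ne_zero hn) (prod_one_sub_X_pow_ne_zero M)
  have hl' := mul_ne_zero hl (prod_one_sub_X_pow_ne_zero (N - M))
  have hr := mul_ne_zero (one_sub_X_pow_ne_zero one_pos) (prod_one_sub_X_pow_ne_zero N)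
  have hle := rootMultiplicity_le_rootMultiplicity_of_dvd hr hdvd ζ
  rw [rootMultiplicity_mul hl', rootMultiplicity_mul hl, rootMultiplicity_mul hr,
    rootMultiplicity_one_sub_X_pow hζ hn, rootMultiplicity_one_sub_X_pow hζ one_pos] at hle
  simp only [rootMultiplicity_prod_one_sub_X_pow hζ, if_pos hdn, Nat.dvd_one, hd.ne',
    if_false] at hle
  by_contra! h
  have hdiv : N / d = M / d + (N - M) / d := by
    conv_lhs => rw [← Nat.add_sub_cancel' hMN]
    refine Nat.add_div_eq_of_add_mod_lt ?_
    have := Nat.add_mod M (N - M) d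
    rw [Nat.add_sub_cancel' hMN] at this
    by_contra! hc
    have h1 := Nat.mod_lt M (by omega : 0 < d)
    have h2 := Nat.mod_lt (N - M) (by omega : 0 < d)
    rw [Nat.mod_eq_sub_mod hc,
      Nat.mod_eq_of_lt (show M % d + (N - M) % d - d < d by omega)] at this
    omega
  omega

/-- A consequence of Kummer's theorem. -/
lemma dvd_choose_of_forall_mod_lt_mod {n L k : ℕ} (hn : 0 < n) (hk : k ≤ L)
    (h : ∀ d, 1 < d → d ∣ n → L % d < k % d) : n ∣ L.choose k := by
  have hc : L.choose k ≠ 0 := (Nat.choose_pos hk).ne'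
  rw [← Nat.factorization_le_iff_dvd hn.ne' hc]
  intro p
  by_cases hp : p.Prime
  swap
  · simp [Nat.factorization_eq_zero_of_not_prime _ hp]
  rw [Nat.factorization_choose hp hk
    (show Nat.log p L < Nat.log p L + n.factorization p + 1 by omega)]
  calc n.factorization p = #(Ico 1 (n.factorization p + 1)) := by simp
    _ ≤ _ := card_le_card fun i hi => ?_
  simp only [mem_Ico, mem_filter] at hi ⊢
  refine ⟨by omega, ?_⟩
  have hlt := h (p ^ i) (Nat.one_lt_pow (by omega) hp.one_lt)
    ((pow_dvd_pow p (by omega)).trans (Nat.ordProj_dvd n p))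
  by_contra! hc
  have hmod := Nat.add_mod k (L - k) (p ^ i)
  rw [Nat.add_sub_cancel' hk, Nat.mod_eq_of_lt hc] at hmod
  exact absurd (hmod ▸ hlt) (Nat.le_add_right _ _).not_gt

lemma sum_Icc_pow_of_pow_eq_one {n : ℕ} {u : ℂ} (hu : u ^ n = 1) (h1 : u ≠ 1) :
    ∑ j ∈ Icc 1 n, u ^ j = 0 := by
  have h := geom_sum_Ico_mul u (show 1 ≤ n + 1 by omega)
  rw [pow_succ, hu, one_mul, pow_one, sub_self, Ico_add_one_right_eq_Icc] at h
  exact (mul_eq_zero.1 h).resolve_right (sub_ne_zero.2 h1)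

theorem stmt7 (n N M : ℕ) (hn : 0 < n) (hMN : M ≤ N) (hA : AIsPoly 1 n N M) (m : ℕ) :
    ∃ z : ℤ,
      (∑ j ∈ Finset.Icc 1 n,
          (Complex.exp (2 * Real.pi * Complex.I / n)) ^ (-(j * M : ℤ)) *
            (1 + (Complex.exp (2 * Real.pi * Complex.I / n)) ^ j) ^ (N + m * n)) =
        (n : ℂ) ^ 2 * z := by
  have hw := Complex.isPrimitiveRoot_exp n hn.ne'
  set w := Complex.exp (2 * Real.pi * Complex.I / n)
  have hw0 : w ≠ 0 := hw.ne_zero hn.ne'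
  have key : ∀ k ∈ range (N + m * n + 1), ∃ z : ℤ,
      (∑ j ∈ Icc 1 n, (w ^ ((k : ℤ) - M)) ^ j) * ((N + m * n).choose k : ℂ) =
        (n : ℂ) ^ 2 * z := by
    intro k hk
    by_cases hu : w ^ ((k : ℤ) - M) = 1
    · have hkM : M ≡ k [MOD n] :=
        (Nat.modEq_iff_dvd).2 ((hw.zpow_eq_one_iff_dvd _).1 hu)
      obtain ⟨c, hc⟩ : n ∣ (N + m * n).choose k := by
        refine dvd_choose_of_forall_mod_lt_mod hn (Nat.lt_succ_iff.1 (mem_range.1 hk))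
          fun d hd hdn => ?_
        have h1 : (N + m * n) % d = N % d := by
          rw [Nat.add_mod, Nat.mod_eq_zero_of_dvd (hdn.mul_left m), add_zero, Nat.mod_mod]
        rw [h1, ← hkM.of_dvd hdn]
        exact hA.mod_lt_mod hn hMN hd hdn
      refine ⟨c, ?_⟩
      rw [hu, hc]
      simp only [one_pow, sum_const, Nat.card_Icc, nsmul_eq_mul, Nat.cast_mul]
      push_cast [Nat.add_sub_cancel]
      ring
    · refine ⟨0, ?_⟩
      have hpow : (w ^ ((k : ℤ) - M)) ^ n = 1 := by
        rw [← zpow_natCast, zpow_comm, zpow_natCast, hw.pow_eq_one, one_zpow]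
      rw [sum_Icc_pow_of_pow_eq_one hpow hu]
      simp
  choose! z hz using key
  refine ⟨∑ k ∈ range (N + m * n + 1), z k, ?_⟩
  rw [Int.cast_sum, mul_sum, ← sum_congr rfl hz]
  simp only [sum_mul]
  rw [sum_comm]
  refine sum_congr rfl fun j _ => ?_
  rw [add_comm (1 : ℂ), add_pow, mul_sum]
  refine sum_congr rfl fun k _ => ?_
  rw [one_pow, mul_one, ← mul_assoc, ← pow_mul, ← zpow_natCast, ← zpow_natCast, ← zpow_mul,
    ← zpow_add₀ hw0]
  congr 2
  push_cast
  ring
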